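/- For every α > 48 there is a constant c > 0 depending only on α such that, with tuning constants α and β = (16/9)(√12 + 2√α)², for all d ≥ 3 and all σ > 0: max over integers s with 1 ≤ s ≤ √(d log d/2) of sup_{θ ∈ Θ_s} P_θ( ŝ > s ) ≤ c d^{-5}. -/

import Mathlib

open MeasureTheory ProbabilityTheory

/-- Law of `y = θ + σ·ξ` with `ξ` i.i.d. standard normal: the product of Gaussians `N(θ j, σ²)`. -/
noncomputable def gaussMeasure (d : ℕ) (θ : Fin d → ℝ) (σ : ℝ) : Measure (Fin d → ℝ) :=
  Measure.pi fun j => gaussianReal (θ j) (Real.toNNReal (σ ^ 2))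

/-- The sparsity class `Θ_s`: vectors with at most `s` nonzero coordinates. -/
def Theta (d s : ℕ) : Set (Fin d → ℝ) := {θ | {j | θ j ≠ 0}.ncard ≤ s}

/-- The linear functional `L(θ) = ∑ θ_j`. -/
noncomputable def Lfun (d : ℕ) (θ : Fin d → ℝ) : ℝ := ∑ j, θ j

/-- The rate `Φ^L(σ, s) = σ² s² log(1 + d (log d) / s²)`. -/
noncomputable def PhiL (d : ℕ) (σ : ℝ) (s : ℕ) : ℝ :=
  σ ^ 2 * (s : ℝ) ^ 2 * Real.log (1 + (d : ℝ) * Real.log d / (s : ℝ) ^ 2)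

/-- The non-adaptive estimators `L̂_s` (known `σ`). -/
noncomputable def LhatS (d : ℕ) (α σ : ℝ) (s : ℕ) (y : Fin d → ℝ) : ℝ :=
  if (s : ℝ) ≤ Real.sqrt ((d : ℝ) * Real.log d / 2) then
    ∑ j, if α * σ ^ 2 * Real.log (1 + (d : ℝ) * Real.log d / (s : ℝ) ^ 2) < (y j) ^ 2
      then y j else 0
  else ∑ j, y j

/-- The threshold `ω_s` with `ω_s² = β σ² s² log(1 + d (log d)/s²)`. -/
noncomputable def omegaS (d : ℕ) (β σ : ℝ) (s : ℕ) : ℝ :=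
  Real.sqrt (β * σ ^ 2 * (s : ℝ) ^ 2 * Real.log (1 + (d : ℝ) * Real.log d / (s : ℝ) ^ 2))

/-- The selected index `ŝ` of the Lepski-type scheme, with the convention
`ŝ = ⌊√(d log d / 2)⌋ + 1` when no index is admissible. -/
noncomputable def shat (d : ℕ) (α β σ : ℝ) (y : Fin d → ℝ) : ℕ :=
  sInf ({s : ℕ | 1 ≤ s ∧ s ≤ Nat.floor (Real.sqrt ((d : ℝ) * Real.log d / 2)) ∧
      ∀ s' : ℕ, s < s' → s' ≤ d → |LhatS d α σ s y - LhatS d α σ s' y| ≤ omegaS d β σ s'}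
    ∪ {Nat.floor (Real.sqrt ((d : ℝ) * Real.log d / 2)) + 1})

/-- The adaptive estimator `L̂ = L̂_{ŝ}`. -/
noncomputable def LhatAdapt (d : ℕ) (α β σ : ℝ) (y : Fin d → ℝ) : ℝ :=
  LhatS d α σ (shat d α β σ y) y


lemma cosh_sub_one_le_aux (z : ℝ) : Real.cosh z ≤ 1 + z ^ 2 / 2 * Real.exp |z| := by
  wlog hz : 0 ≤ z with H
  · have := H (-z) (by linarith)
    simpa using this
  rw [abs_of_nonneg hz, Real.cosh_eq]
  have h1 : 1 - z ≤ Real.exp (-z) := by linarith [Real.add_one_le_exp (-z)]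
  have h2 : Real.exp (-z) ≤ 1 := by simpa using hz
  have h3 : Real.exp z * Real.exp (-z) = 1 := by rw [← Real.exp_add]; simp
  have h4 : (1 - Real.exp (-z)) ^ 2 ≤ z ^ 2 := by
    apply pow_le_pow_left₀ <;> linarith
  have h5 := mul_le_mul_of_nonneg_left h4 (Real.exp_pos z).le
  have h6 : Real.exp z * (1 - Real.exp (-z)) ^ 2 = Real.exp z + Real.exp (-z) - 2 := by
    linear_combination (-2 + Real.exp (-z)) * h3
  linarith

lemma chernoff_aux (d : ℕ) (μ : Fin d → Measure ℝ) [∀ j, IsProbabilityMeasure (μ j)]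
    (f : Fin d → ℝ → ℝ) (l v u : ℝ) (hl : 0 ≤ l)
    (hi : ∀ j, Integrable (fun x => Real.exp (l * f j x)) (μ j))
    (hb : ∀ j, ∫ x, Real.exp (l * f j x) ∂(μ j) ≤ Real.exp v) :
    (Measure.pi μ) {y | u ≤ ∑ j, f j (y j)} ≤ ENNReal.ofReal (Real.exp (d * v - l * u)) := by
  have e : ∀ y : Fin d → ℝ, Real.exp (l * ∑ j, f j (y j)) = ∏ j, Real.exp (l * f j (y j)) := by
    intro y; rw [Finset.mul_sum, Real.exp_sum]
  have hI : Integrable (fun y : Fin d → ℝ => Real.exp (l * ∑ j, f j (y j))) (Measure.pi μ) := by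
    simp_rw [e]
    exact Integrable.fintype_prod_dep hi
  have h := measure_ge_le_exp_mul_mgf (X := fun y : Fin d → ℝ => ∑ j, f j (y j)) u hl hI
  have h2 : mgf (fun y : Fin d → ℝ => ∑ j, f j (y j)) (Measure.pi μ) l ≤ Real.exp (d * v) := by
    unfold mgf
    simp_rw [e]
    rw [integral_fintype_prod_eq_prod (fun j x => Real.exp (l * f j x))]
    calc _ ≤ ∏ _j : Fin d, Real.exp v :=
          Finset.prod_le_prod (fun j _ => integral_nonneg fun x => (Real.exp_pos _).le)
            (fun j _ => hb j)
      _ = _ := by simp [← Real.exp_nat_mul]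
  have h3 : (Measure.pi μ).real {y | u ≤ ∑ j, f j (y j)} ≤ Real.exp (d * v - l * u) := by
    refine h.trans ?_
    calc _ ≤ Real.exp (-l * u) * Real.exp (d * v) := by gcongr
      _ = _ := by rw [← Real.exp_add]; ring_nf
  rw [← ofReal_measureReal]
  exact ENNReal.ofReal_le_ofReal h3

lemma gauss_exp_sq_aux (v : NNReal) (hv : v ≠ 0) :
    Integrable (fun x : ℝ => Real.exp (3 * x ^ 2 / (8 * v))) (gaussianReal 0 v) ∧
    ∫ x : ℝ, Real.exp (3 * x ^ 2 / (8 * v)) ∂(gaussianReal 0 v) = 2 := by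
  have hv' : (0 : ℝ) < v := by positivity
  have key : ∫ x : ℝ, Real.exp (3 * x ^ 2 / (8 * v)) ∂(gaussianReal 0 v) = 2 := by
    rw [integral_gaussianReal_eq_integral_smul hv]
    have : ∀ x : ℝ, gaussianPDFReal 0 v x • Real.exp (3 * x ^ 2 / (8 * v)) =
        (√(2 * Real.pi * v))⁻¹ * Real.exp (-(1 / (8 * v)) * x ^ 2) := by
      intro x
      rw [gaussianPDFReal_def, smul_eq_mul, mul_assoc, ← Real.exp_add]
      congr 2
      field_simp
      ring
    simp_rw [this]
    rw [integral_const_mul, integral_gaussian]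
    have : Real.pi / (1 / (8 * (v : ℝ))) = 2 ^ 2 * (2 * Real.pi * v) := by
      field_simp; norm_num
    rw [this, Real.sqrt_mul (x := 2 ^ 2) (by positivity), Real.sqrt_sq (by positivity)]
    have : √(2 * Real.pi * v) ≠ 0 := by positivity
    field_simp
  refine ⟨?_, key⟩
  by_contra h
  rw [integral_undef h] at key
  norm_num at key

lemma gauss_odd_aux (v : NNReal) (g : ℝ → ℝ) (hg : Measurable g) (hodd : ∀ x, g (-x) = - g x)
    (M : ℝ) (hM : ∀ x, |g x| ≤ M) (l : ℝ) :
    Integrable (fun x => Real.exp (l * g x)) (gaussianReal 0 v) ∧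
    ∫ x, Real.exp (l * g x) ∂(gaussianReal 0 v) = ∫ x, Real.cosh (l * g x) ∂(gaussianReal 0 v) := by
  have hI : ∀ l : ℝ, Integrable (fun x => Real.exp (l * g x)) (gaussianReal 0 v) := by
    intro l
    refine Integrable.of_bound (C := Real.exp (|l| * M)) (by fun_prop) (ae_of_all _ fun x => ?_)
    rw [Real.norm_eq_abs, Real.abs_exp]
    apply Real.exp_le_exp.2
    calc l * g x ≤ |l * g x| := le_abs_self _
      _ = |l| * |g x| := abs_mul _ _
      _ ≤ _ := mul_le_mul_of_nonneg_left (hM x) (abs_nonneg l)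
  refine ⟨hI l, ?_⟩
  have h1 : ∫ x, Real.exp (l * g x) ∂(gaussianReal 0 v)
      = ∫ x, Real.exp (-l * g x) ∂(gaussianReal 0 v) := by
    conv_lhs => rw [show gaussianReal 0 v = (gaussianReal 0 v).map (fun x => -x) by
      rw [gaussianReal_map_neg, neg_zero]]
    rw [integral_map (by fun_prop) (by fun_prop)]
    simp [hodd]
  have h2 : ∫ x, Real.cosh (l * g x) ∂(gaussianReal 0 v) =
      (∫ x, Real.exp (l * g x) ∂(gaussianReal 0 v)
        + ∫ x, Real.exp (-l * g x) ∂(gaussianReal 0 v)) / 2 := by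
    rw [← integral_add (hI l) (hI (-l)), ← integral_div]
    simp [Real.cosh_eq]
  rw [h2, ← h1]; ring

/-- the band function -/
noncomputable def band (P : ℝ → Prop) (T : ℝ) (x : ℝ) : ℝ :=
  open Classical in if x ^ 2 ≤ T ∧ P (x ^ 2) then x else 0

lemma band_odd (P : ℝ → Prop) (T x : ℝ) : band P T (-x) = - band P T x := by
  have e : (-x) ^ 2 = x ^ 2 := neg_sq x
  unfold band
  by_cases h : x ^ 2 ≤ T ∧ P (x ^ 2)
  · rw [if_pos h, if_pos (by rw [e]; exact h)]
  · rw [if_neg h, if_neg (by rw [e]; exact h), neg_zero]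

lemma band_abs_le (P : ℝ → Prop) (T x : ℝ) : |band P T x| ≤ √T := by
  unfold band
  split_ifs with h
  · exact Real.abs_le_sqrt h.1
  · simp

lemma band_abs_le' (P : ℝ → Prop) (T x : ℝ) : |band P T x| ≤ |x| := by
  unfold band
  split_ifs with h
  · exact le_rfl
  · simp

lemma band_meas (P : ℝ → Prop) (hP : MeasurableSet {x | P x}) (T : ℝ) : Measurable (band P T) := by
  unfold band
  refine Measurable.ite ?_ measurable_id measurable_const
  have h1 : Measurable fun x : ℝ => x ^ 2 := by fun_prop
  exact (measurableSet_le h1 measurable_const).inter (h1 hP)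

lemma band_mgf_full (v : NNReal) (P : ℝ → Prop) (hP : MeasurableSet {x | P x}) (T l : ℝ) :
    ∫ x, Real.exp (l * band P T x) ∂(gaussianReal 0 v) ≤ Real.exp (v * l ^ 2 / 2) := by
  rw [(gauss_odd_aux v _ (band_meas P hP T) (band_odd P T) _ (band_abs_le P T) l).2]
  have hid := fun l : ℝ => integrable_exp_mul_gaussianReal (μ := 0) (v := v) l
  have hc : Integrable (fun x => Real.cosh (l * x)) (gaussianReal 0 v) := by
    have := ((hid l).add (hid (-l))).div_const 2
    refine this.congr (ae_of_all _ fun x => ?_)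
    simp [Real.cosh_eq]
  have hm : ∀ l : ℝ, ∫ x, Real.exp (l * x) ∂(gaussianReal 0 v) = Real.exp (v * l ^ 2 / 2) := by
    intro l
    have := mgf_gaussianReal (p := gaussianReal 0 v) (X := id) (μ := 0) (v := v) (by simp) l
    simpa [mgf] using this
  calc _ ≤ ∫ x, Real.cosh (l * x) ∂(gaussianReal 0 v) := by
        refine integral_mono_of_nonneg (ae_of_all _ fun x => (Real.cosh_pos _).le) hc
          (ae_of_all _ fun x => ?_)
        simp only [Real.cosh_le_cosh, abs_mul]
        exact mul_le_mul_of_nonneg_left (band_abs_le' P T x) (abs_nonneg l)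
    _ = (∫ x, Real.exp (l * x) ∂(gaussianReal 0 v)
        + ∫ x, Real.exp (-l * x) ∂(gaussianReal 0 v)) / 2 := by
        rw [← integral_add (hid l) (hid (-l)), ← integral_div]
        simp [Real.cosh_eq]
    _ = _ := by rw [hm, hm]; ring_nf

lemma band_mgf_tail (v : NNReal) (hv : v ≠ 0) (T' T l : ℝ) (hl : 0 ≤ l)
    (hlT : (8 * v * l) ^ 2 ≤ T') :
    ∫ x, Real.exp (l * band (fun z => T' < z) T x) ∂(gaussianReal 0 v) ≤
      Real.exp (8 * v * l ^ 2 * Real.exp (-(T' / (8 * v)))) := by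
  have hv' : (0 : ℝ) < v := by positivity
  rw [(gauss_odd_aux v _ (band_meas _ measurableSet_Ioi T) (band_odd _ T) _ (band_abs_le _ T) l).2]
  obtain ⟨hI, hE⟩ := gauss_exp_sq_aux v hv
  set K := 4 * v * l ^ 2 * Real.exp (-(T' / (8 * v))) with hK
  have hK0 : 0 ≤ K := by positivity
  have pt : ∀ x, Real.cosh (l * band (fun z => T' < z) T x) ≤
      1 + K * Real.exp (3 * x ^ 2 / (8 * v)) := by
    intro x
    by_cases h : x ^ 2 ≤ T ∧ T' < x ^ 2
    · have hb : band (fun z => T' < z) T x = x := by unfold band; rw [if_pos h]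
      rw [hb]
      have hx : 8 * v * l ≤ |x| := by
        apply abs_le_of_sq_le_sq' _ (abs_nonneg _) |>.2
        rw [sq_abs]; linarith
      have h1 : |l * x| ≤ x ^ 2 / (8 * v) := by
        rw [le_div_iff₀ (by positivity), abs_mul, abs_of_nonneg hl, ← sq_abs x]
        nlinarith [abs_nonneg x]
      have h2 : x ^ 2 ≤ 8 * v * Real.exp (x ^ 2 / (8 * v)) := by
        have := Real.add_one_le_exp (x ^ 2 / (8 * v))
        have h3 : x ^ 2 / (8 * v) ≤ Real.exp (x ^ 2 / (8 * v)) := by linarith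
        rw [div_le_iff₀ (by positivity)] at h3
        linarith
      have h4 : (1 : ℝ) ≤ Real.exp (-(T' / (8 * v))) * Real.exp (x ^ 2 / (8 * v)) := by
        rw [← Real.exp_add]
        apply Real.one_le_exp
        have : T' / (8 * v) ≤ x ^ 2 / (8 * v) := by gcongr; exact h.2.le
        linarith
      refine (cosh_sub_one_le_aux _).trans ?_
      have e3 : Real.exp (3 * x ^ 2 / (8 * v)) = Real.exp (x ^ 2 / (8 * v)) *
          Real.exp (x ^ 2 / (8 * v)) * Real.exp (x ^ 2 / (8 * v)) := by
        rw [← Real.exp_add, ← Real.exp_add]; congr 1; ring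
      rw [hK, e3]
      set E := Real.exp (x ^ 2 / (8 * v))
      have hE0 : 0 < E := Real.exp_pos _
      calc 1 + (l * x) ^ 2 / 2 * Real.exp |l * x|
          ≤ 1 + (l ^ 2 * (8 * v * E)) / 2 * E := by
            have h5 : Real.exp |l * x| ≤ E := Real.exp_le_exp.2 h1
            rw [mul_pow]; gcongr
        _ = 1 + 4 * v * l ^ 2 * E * E * 1 := by ring
        _ ≤ 1 + 4 * v * l ^ 2 * E * E * (Real.exp (-(T' / (8 * v))) * E) := by gcongr
        _ = _ := by ring
    · have hb : band (fun z => T' < z) T x = 0 := by unfold band; rw [if_neg h]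
      rw [hb]
      simp
      positivity
  have hI2 : Integrable (fun x : ℝ => 1 + K * Real.exp (3 * x ^ 2 / (8 * v))) (gaussianReal 0 v) :=
    (integrable_const _).add (hI.const_mul K)
  calc _ ≤ ∫ x : ℝ, 1 + K * Real.exp (3 * x ^ 2 / (8 * v)) ∂(gaussianReal 0 v) :=
        integral_mono_of_nonneg (ae_of_all _ fun x => (Real.cosh_pos _).le) hI2 (ae_of_all _ pt)
    _ = 1 + K * 2 := by
        rw [integral_add (integrable_const _) (hI.const_mul K), integral_const_mul, hE]
        simp
    _ ≤ Real.exp (K * 2) := by linarith [Real.add_one_le_exp (K * 2)]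
    _ = _ := by rw [hK]; ring_nf

lemma mul_log_mono_aux (a p q : ℝ) (ha : 0 < a) (hp : 0 < p) (hpq : p ≤ q) :
    p * Real.log (1 + a / p) ≤ q * Real.log (1 + a / q) := by
  have hq : 0 < q := by linarith
  have h := one_add_mul_self_le_rpow_one_add (s := a / q) (p := q / p)
    (by have : 0 < a / q := by positivity
        linarith) ((one_le_div hp).2 hpq)
  have e : q / p * (a / q) = a / p := by field_simp
  rw [e] at h
  have h2 := Real.log_le_log (by positivity) h
  rw [Real.log_rpow (by positivity)] at h2
  calc _ ≤ p * (q / p * Real.log (1 + a / q)) := by gcongr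
    _ = _ := by field_simp

lemma one_le_log_three : (1 : ℝ) ≤ Real.log 3 := by
  rw [Real.le_log_iff_exp_le (by norm_num)]
  linarith [Real.exp_one_lt_d9]

lemma log_le_aux (D : ℝ) (hD : 3 ≤ D) (s : ℕ) (hs : 1 ≤ s) (h : (s : ℝ) ^ 2 ≤ D * Real.log D / 2) :
    Real.log D ≤ 2 * (s * Real.log (1 + D * Real.log D / (s : ℝ) ^ 2)) := by
  have hL : 1 ≤ Real.log D := one_le_log_three.trans (Real.log_le_log (by norm_num) hD)
  have hs0 : (0 : ℝ) < s := by positivity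
  set a := D * Real.log D with ha
  have ha0 : 0 < a := by positivity
  have hr : 0 < a / (s : ℝ) ^ 2 := by positivity
  have h1 := one_add_mul_le_pow (a := a / (s : ℝ) ^ 2) (by linarith) s
  have h2 : (s : ℝ) * (a / (s : ℝ) ^ 2) = a / s := by field_simp
  rw [h2] at h1
  have h3 : D ≤ (a / s) ^ 2 := by
    rw [div_pow, le_div_iff₀ (by positivity)]
    have : D ≤ a := by rw [ha]; nlinarith
    nlinarith
  have h4 : (a / s) ^ 2 ≤ ((1 + a / (s : ℝ) ^ 2) ^ s) ^ 2 := by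
    have : 0 < a / s := by positivity
    apply pow_le_pow_left₀ this.le; linarith
  have h5 := Real.log_le_log (by linarith) (h3.trans h4)
  rw [Real.log_pow, Real.log_pow] at h5
  exact_mod_cast h5

lemma two_sided_aux (d s : ℕ) (θ : Fin d → ℝ) (σ : ℝ) (hθ : θ ∈ Theta d s)
    (P : ℝ → Prop) (hP : MeasurableSet {x | P x}) (T l v u : ℝ) (hl : 0 ≤ l) (hv : 0 ≤ v)
    (hb : ∫ x, Real.exp (l * band P T x) ∂(gaussianReal 0 (Real.toNNReal (σ ^ 2))) ≤ Real.exp v) :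
    gaussMeasure d θ σ {y | s * √T + u < |∑ j, band P T (y j)|} ≤
      ENNReal.ofReal (2 * Real.exp (d * v - l * u)) := by
  classical
  have H := gauss_odd_aux (Real.toNNReal (σ ^ 2)) _ (band_meas P hP T) (band_odd P T) _
    (band_abs_le P T)
  let f : ℝ → Fin d → ℝ → ℝ := fun ε j x => if θ j = 0 then ε * band P T x else 0
  have key : ∀ ε : ℝ, (ε = 1 ∨ ε = -1) → gaussMeasure d θ σ {y | u ≤ ∑ j, f ε j (y j)} ≤
      ENNReal.ofReal (Real.exp (d * v - l * u)) := by
    intro ε hε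
    have hb' : ∫ x, Real.exp (l * ε * band P T x) ∂(gaussianReal 0 (Real.toNNReal (σ ^ 2)))
        ≤ Real.exp v := by
      rcases hε with rfl | rfl
      · simpa using hb
      · rw [(H _).2]
        rw [(H _).2] at hb
        simpa using hb
    unfold gaussMeasure
    apply chernoff_aux _ _ _ l v u hl
    · intro j
      by_cases h : θ j = 0
      · simp only [f, h, if_true, ← mul_assoc]
        exact (H _).1
      · simp [f, h]
    · intro j
      by_cases h : θ j = 0
      · simp only [f, h, if_true, ← mul_assoc]
        exact hb'
      · simp [f, h, hv]
  have hsub : {y : Fin d → ℝ | s * √T + u < |∑ j, band P T (y j)|} ⊆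
      {y | u ≤ ∑ j, f 1 j (y j)} ∪ {y | u ≤ ∑ j, f (-1) j (y j)} := by
    intro y hy
    simp only [Set.mem_setOf_eq] at hy
    have e1 : ∑ j, f (-1) j (y j) = - ∑ j, f 1 j (y j) := by
      rw [← Finset.sum_neg_distrib]
      refine Finset.sum_congr rfl fun j _ => ?_
      simp only [f]; split_ifs <;> simp
    have e2 : ∑ j, band P T (y j) = ∑ j, f 1 j (y j) +
        ∑ j with θ j ≠ 0, band P T (y j) := by
      rw [Finset.sum_filter, ← Finset.sum_add_distrib]
      refine Finset.sum_congr rfl fun j _ => ?_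
      by_cases h : θ j = 0 <;> simp [f, h]
    have e3 : |∑ j with θ j ≠ 0, band P T (y j)| ≤ s * √T := by
      have hc : (Finset.univ.filter fun j => θ j ≠ 0).card ≤ s := by
        have h : {j | θ j ≠ 0}.ncard ≤ s := hθ
        rw [Set.ncard_eq_toFinset_card'] at h
        simpa using h
      calc _ ≤ ∑ j with θ j ≠ 0, |band P T (y j)| := Finset.abs_sum_le_sum_abs _ _
        _ ≤ ∑ j with θ j ≠ 0, √T := Finset.sum_le_sum fun j _ => band_abs_le _ _ _
        _ = (Finset.univ.filter fun j => θ j ≠ 0).card * √T := by simp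
        _ ≤ _ := by gcongr
    rw [e2] at hy
    have h4 := abs_add_le (∑ j, f 1 j (y j)) (∑ j with θ j ≠ 0, band P T (y j))
    have h5 : u < |∑ j, f 1 j (y j)| := by linarith
    rcases lt_abs.1 h5 with h | h
    · left; exact h.le
    · right; simp only [Set.mem_setOf_eq, e1]; exact h.le
  calc _ ≤ _ := measure_mono hsub
    _ ≤ _ := measure_union_le _ _
    _ ≤ _ := add_le_add (key 1 (Or.inl rfl)) (key (-1) (Or.inr rfl))
    _ = _ := by
      rw [← ENNReal.ofReal_add (Real.exp_pos _).le (Real.exp_pos _).le]; ring_nf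

/-- threshold -/
noncomputable def thr (d : ℕ) (α σ : ℝ) (s : ℕ) : ℝ :=
  α * σ ^ 2 * Real.log (1 + (d : ℝ) * Real.log d / (s : ℝ) ^ 2)

lemma exp_fin_aux (d : ℕ) (hd : 3 ≤ d) (x : ℝ) (hx : x ≤ - 6 * Real.log d) :
    2 * Real.exp x ≤ 2 / (d : ℝ) ^ 6 := by
  have hd0 : (0 : ℝ) < d := by positivity
  have : Real.exp (- 6 * Real.log d) = ((d : ℝ) ^ 6)⁻¹ := by
    rw [neg_mul, Real.exp_neg]
    congr 1
    rw [mul_comm, Real.exp_mul, Real.exp_log hd0]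
    exact_mod_cast rfl
  have h := Real.exp_le_exp.2 hx
  rw [this] at h
  rw [div_eq_mul_inv]
  linarith

set_option maxHeartbeats 2000000 in
lemma pair_aux (α : ℝ) (hα : 48 < α) (d : ℕ) (hd : 3 ≤ d) (σ : ℝ) (hσ : 0 < σ) (s s' : ℕ)
    (hs : 1 ≤ s) (hs0 : (s : ℝ) ≤ Real.sqrt ((d : ℝ) * Real.log d / 2)) (hss : s < s')
    (θ : Fin d → ℝ) (hθ : θ ∈ Theta d s) :
    gaussMeasure d θ σ {y | omegaS d (16 / 9 * (Real.sqrt 12 + 2 * Real.sqrt α) ^ 2) σ s' <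
      |LhatS d α σ s y - LhatS d α σ s' y|} ≤ ENNReal.ofReal (2 / (d : ℝ) ^ 6) := by
  have hD : (3 : ℝ) ≤ d := by exact_mod_cast hd
  have hL : 1 ≤ Real.log d := one_le_log_three.trans (Real.log_le_log (by norm_num) hD)
  set L := Real.log d with hLdef
  set a := (d : ℝ) * L with ha
  have ha0 : 0 < a := by positivity
  have hs1 : (1 : ℝ) ≤ s := by exact_mod_cast hs
  have hss' : (s : ℝ) ≤ s' := by exact_mod_cast hss.le
  have hs'0 : (0 : ℝ) < s' := by linarith
  have hs2 : (0 : ℝ) < s := by linarith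
  set x := Real.log (1 + a / (s : ℝ) ^ 2) with hx
  set x' := Real.log (1 + a / (s' : ℝ) ^ 2) with hx'
  have hr0 : 0 < a / (s : ℝ) ^ 2 := by positivity
  have hr'0 : 0 < a / (s' : ℝ) ^ 2 := by positivity
  have hx0 : 0 < x := Real.log_pos (by linarith)
  have hx'0 : 0 < x' := Real.log_pos (by linarith)
  have hxx : x' ≤ x := by
    apply Real.log_le_log (by linarith)
    gcongr
  have hmono : (s : ℝ) ^ 2 * x ≤ (s' : ℝ) ^ 2 * x' :=
    mul_log_mono_aux a _ _ ha0 (by positivity) (by gcongr)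
  -- constants
  set q := √α with hq
  have hqq : q ^ 2 = α := Real.sq_sqrt (by linarith)
  have hq0 : 0 ≤ q := Real.sqrt_nonneg _
  set p := √(12 : ℝ) with hp
  have hpp : p ^ 2 = 12 := Real.sq_sqrt (by norm_num)
  have hp0 : 0 ≤ p := Real.sqrt_nonneg _
  have hpq : 24 ≤ p * q := by
    apply abs_le_of_sq_le_sq' _ (by positivity) |>.2
    rw [mul_pow, hpp, hqq]; linarith
  have hp3 : 3.46 ≤ p := by
    apply abs_le_of_sq_le_sq' _ (by positivity) |>.2
    rw [hpp]; norm_num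
  have hq3 : 6.9 ≤ q := by
    apply abs_le_of_sq_le_sq' _ (by positivity) |>.2
    rw [hqq]; linarith
  obtain ⟨C, hC⟩ : ∃ C, C = 4 / 3 * p + 5 / 3 * q := ⟨_, rfl⟩
  have hC16 : 16 ≤ C := by rw [hC]; linarith
  have hCq : 112 ≤ C * q := by
    have : C * q = 4 / 3 * (p * q) + 5 / 3 * q ^ 2 := by rw [hC]; ring
    rw [this, hqq]; linarith
  have hsx' : 0 < √x' := Real.sqrt_pos.2 hx'0
  have hsx'2 : √x' ^ 2 = x' := Real.sq_sqrt hx'0.le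
  have hom : omegaS d (16 / 9 * (p + 2 * q) ^ 2) σ s' = (C + q) * (σ * s' * √x') := by
    unfold omegaS
    have : 16 / 9 * (p + 2 * q) ^ 2 * σ ^ 2 * (s' : ℝ) ^ 2 * x' =
        ((C + q) * (σ * s' * √x')) ^ 2 := by
      rw [mul_pow, mul_pow, mul_pow, hsx'2, hC]; ring
    rw [← hLdef, ← ha, ← hx', this, Real.sqrt_sq]
    positivity
  have hT : thr d α σ s = α * σ ^ 2 * x := rfl
  have hT' : thr d α σ s' = α * σ ^ 2 * x' := rfl
  have hTT : thr d α σ s' ≤ thr d α σ s := by rw [hT, hT']; gcongr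
  have hsT : s * √(thr d α σ s) ≤ q * (σ * s' * √x') := by
    apply abs_le_of_sq_le_sq' _ (by positivity) |>.2
    rw [hT, mul_pow, Real.sq_sqrt (by positivity), mul_pow, mul_pow, mul_pow, hsx'2, hqq]
    have h := mul_le_mul_of_nonneg_left hmono (show 0 ≤ α * σ ^ 2 by positivity)
    linarith
  have hNN : ((Real.toNNReal (σ ^ 2) : NNReal) : ℝ) = σ ^ 2 := Real.coe_toNNReal _ (by positivity)
  have hNN0 : Real.toNNReal (σ ^ 2) ≠ 0 := by
    intro h; rw [h] at hNN; simp only [NNReal.coe_zero] at hNN; linarith [pow_pos hσ 2]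
  set u := C * (σ * s' * √x') with hu
  have hu0 : 0 < u := by positivity
  -- generic step
  have gen : ∀ (P : ℝ → Prop) (_ : MeasurableSet {x | P x}) (l v : ℝ), 0 ≤ l → 0 ≤ v →
      (∀ y, LhatS d α σ s y - LhatS d α σ s' y = - ∑ j, band P (thr d α σ s) (y j)) →
      (∫ x, Real.exp (l * band P (thr d α σ s) x) ∂(gaussianReal 0 (Real.toNNReal (σ ^ 2)))
        ≤ Real.exp v) → d * v - l * u ≤ - 6 * L →
      gaussMeasure d θ σ {y | omegaS d (16 / 9 * (p + 2 * q) ^ 2) σ s' <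
      |LhatS d α σ s y - LhatS d α σ s' y|} ≤ ENNReal.ofReal (2 / (d : ℝ) ^ 6) := by
    intro P hP l v hl hv hdec hint hexp
    refine le_trans (measure_mono ?_) ((two_sided_aux d s θ σ hθ P hP (thr d α σ s) l v u hl hv
      hint).trans (ENNReal.ofReal_le_ofReal (exp_fin_aux d hd _ hexp)))
    intro y hy
    simp only [Set.mem_setOf_eq] at hy ⊢
    rw [hdec, abs_neg, hom] at hy
    linarith
  by_cases hcase : (s' : ℝ) ≤ √(a / 2)
  · -- both thresholded
    have hs'2 : (s' : ℝ) ^ 2 ≤ a / 2 := by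
      rw [← Real.sq_sqrt (show 0 ≤ a / 2 by positivity)]; gcongr
    have hlow := log_le_aux d hD s' (by omega) hs'2
    rw [← hLdef, ← ha, ← hx'] at hlow
    have hr2 : 2 ≤ a / (s' : ℝ) ^ 2 := by
      rw [le_div_iff₀ (by positivity)]; linarith
    have hx'1 : 1 ≤ x' := one_le_log_three.trans (Real.log_le_log (by norm_num) (by linarith))
    set l := 7 * L / u with hl
    have hl0 : 0 ≤ l := by positivity
    have hlu : l * u = 7 * L := by rw [hl]; field_simp
    refine gen (fun z => thr d α σ s' < z) measurableSet_Ioi l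
      (8 * σ ^ 2 * l ^ 2 * Real.exp (-(thr d α σ s' / (8 * σ ^ 2)))) hl0 (by positivity) ?_ ?_ ?_
    · intro y
      unfold LhatS
      rw [if_pos hs0, if_pos hcase, ← Finset.sum_sub_distrib, ← Finset.sum_neg_distrib]
      refine Finset.sum_congr rfl fun j _ => ?_
      change (if thr d α σ s < y j ^ 2 then y j else 0) -
        (if thr d α σ s' < y j ^ 2 then y j else 0) = _
      unfold band
      by_cases h1 : thr d α σ s < y j ^ 2
      · have h2 := hTT.trans_lt h1
        simp [h1, h2]
      · by_cases h2 : thr d α σ s' < y j ^ 2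
        · simp [h1, h2, not_lt.1 h1]
        · simp [h1, h2]
    · have := band_mgf_tail (Real.toNNReal (σ ^ 2)) hNN0 (thr d α σ s') (thr d α σ s) l hl0 ?_
      · rw [hNN] at this; exact this
      · rw [hNN]
        have h1 : 8 * σ ^ 2 * l ≤ q * σ * √x' := by
          rw [hl, hu, ← mul_div_assoc, div_le_iff₀ (by positivity)]
          have e : q * σ * √x' * (C * (σ * s' * √x')) = σ ^ 2 * ((C * q) * (s' * x')) := by
            linear_combination (q * σ ^ 2 * C * s') * hsx'2
          rw [e]
          have h2 : 112 * (L / 2) ≤ (C * q) * (s' * x') :=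
            mul_le_mul hCq (by linarith) (by positivity) (by positivity)
          have h3 : 0 ≤ σ ^ 2 := by positivity
          have h4 := mul_le_mul_of_nonneg_left h2 h3
          linarith
        calc (8 * σ ^ 2 * l) ^ 2 ≤ (q * σ * √x') ^ 2 := by gcongr
          _ = _ := by rw [hT', mul_pow, mul_pow, hsx'2, hqq]
    · rw [hlu]
      have e1 : thr d α σ s' / (8 * σ ^ 2) = α / 8 * x' := by
        rw [hT']; field_simp
      have e2 : Real.exp (-(α / 8 * x')) ≤ ((1 + a / (s' : ℝ) ^ 2) ^ 2)⁻¹ := by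
        have : Real.exp (-(2 * x')) = ((1 + a / (s' : ℝ) ^ 2) ^ 2)⁻¹ := by
          rw [Real.exp_neg, two_mul, Real.exp_add, hx', Real.exp_log (by linarith), ← sq]
        rw [← this]
        apply Real.exp_le_exp.2
        have := mul_le_mul_of_nonneg_right (show 2 ≤ α / 8 by linarith) hx'0.le
        linarith
      rw [e1]
      have e3 : (d : ℝ) * (8 * σ ^ 2 * l ^ 2) = 392 / (C ^ 2 * x') * (a / (s' : ℝ) ^ 2) * L := by
        rw [hl, hu, div_pow, mul_pow, mul_pow C, mul_pow, mul_pow, hsx'2, ha]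
        field_simp
        norm_num
      have e4 : 392 / (C ^ 2 * x') ≤ 2 := by
        rw [div_le_iff₀ (by positivity)]
        have h1 : (16 : ℝ) ^ 2 ≤ C ^ 2 := by gcongr
        have h2 : (16 : ℝ) ^ 2 * 1 ≤ C ^ 2 * x' := mul_le_mul h1 hx'1 (by norm_num) (by positivity)
        linarith
      have e5 : (a / (s' : ℝ) ^ 2) * ((1 + a / (s' : ℝ) ^ 2) ^ 2)⁻¹ ≤ 1 / 4 := by
        rw [← div_eq_mul_inv, div_le_iff₀ (by positivity)]
        linarith [sq_nonneg (1 - a / (s' : ℝ) ^ 2)]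
      have : (d : ℝ) * (8 * σ ^ 2 * l ^ 2 * Real.exp (-(α / 8 * x'))) ≤ 2 * (1 / 4) * L := by
        calc _ = (d : ℝ) * (8 * σ ^ 2 * l ^ 2) * Real.exp (-(α / 8 * x')) := by ring
          _ ≤ (392 / (C ^ 2 * x') * (a / (s' : ℝ) ^ 2) * L) * ((1 + a / (s' : ℝ) ^ 2) ^ 2)⁻¹ := by
            rw [e3]; gcongr
          _ = 392 / (C ^ 2 * x') * ((a / (s' : ℝ) ^ 2) * ((1 + a / (s' : ℝ) ^ 2) ^ 2)⁻¹) * L := by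
            ring
          _ ≤ _ := by gcongr
      linarith
  · -- plain sum
    have hs'2 : a / 2 ≤ (s' : ℝ) ^ 2 := by
      rw [← Real.sq_sqrt (show 0 ≤ a / 2 by positivity)]
      have := (not_le.1 hcase).le
      gcongr
    have hlow := mul_log_mono_aux a (a / 2) _ ha0 (by positivity) hs'2
    rw [← hx', show 1 + a / (a / 2) = 3 by field_simp; norm_num] at hlow
    have hlow2 : a / 2 ≤ (s' : ℝ) ^ 2 * x' := by
      have := mul_le_mul_of_nonneg_left one_le_log_three (show 0 ≤ a / 2 by positivity)
      linarith
    set l := u / (d * σ ^ 2) with hl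
    have hl0 : 0 ≤ l := by positivity
    refine gen (fun _ => True) (by simp) l (σ ^ 2 * l ^ 2 / 2) hl0 (by positivity) ?_ ?_ ?_
    · intro y
      unfold LhatS
      rw [if_pos hs0, if_neg hcase, ← Finset.sum_sub_distrib, ← Finset.sum_neg_distrib]
      refine Finset.sum_congr rfl fun j _ => ?_
      change (if thr d α σ s < y j ^ 2 then y j else 0) - y j = _
      unfold band
      by_cases h1 : thr d α σ s < y j ^ 2
      · simp [h1]
      · simp [h1, not_lt.1 h1]
    · have := band_mgf_full (Real.toNNReal (σ ^ 2)) (fun _ => True) (by simp) (thr d α σ s) l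
      rw [hNN] at this; exact this
    · have e : d * (σ ^ 2 * l ^ 2 / 2) - l * u = - (C ^ 2 * ((s' : ℝ) ^ 2 * x') / (2 * d)) := by
        have e0 : u ^ 2 = C ^ 2 * (σ ^ 2 * ((s' : ℝ) ^ 2 * x')) := by
          rw [hu, mul_pow, mul_pow, mul_pow, hsx'2]; ring
        have e00 : d * (σ ^ 2 * l ^ 2 / 2) - l * u = - (u ^ 2 / (2 * d * σ ^ 2)) := by
          rw [hl]; field_simp; ring
        rw [e00, e0]; field_simp
      rw [e]
      have : 6 * L ≤ C ^ 2 * ((s' : ℝ) ^ 2 * x') / (2 * d) := by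
        rw [le_div_iff₀ (by positivity)]
        calc 6 * L * (2 * d) = 24 * (a / 2) := by rw [ha]; ring
          _ ≤ C ^ 2 * ((s' : ℝ) ^ 2 * x') := by
            apply mul_le_mul _ hlow2 (by positivity) (by positivity)
            have h1 : (16 : ℝ) ^ 2 ≤ C ^ 2 := by gcongr
            linarith
      linarith

/-- Lemma 2 (i): with `β = (16/9)(√12 + 2√α)²` and `α > 48`, for every
`s ≤ √(d log d / 2)`, `P_θ(ŝ > s) ≤ c d⁻⁵` uniformly over `Θ_s`. -/
theorem shat_overshoot_probability :
    ∀ α : ℝ, 48 < α → ∃ c : ℝ, 0 < c ∧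
      ∀ d : ℕ, 3 ≤ d → ∀ σ : ℝ, 0 < σ →
        ∀ s : ℕ, 1 ≤ s → (s : ℝ) ≤ Real.sqrt ((d : ℝ) * Real.log d / 2) →
          ∀ θ ∈ Theta d s,
            gaussMeasure d θ σ
                {y | s < shat d α (16 / 9 * (Real.sqrt 12 + 2 * Real.sqrt α) ^ 2) σ y}
              ≤ ENNReal.ofReal (c / (d : ℝ) ^ 5) := by
  intro α hα
  refine ⟨2, by norm_num, ?_⟩
  intro d hd σ hσ s hs hs0 θ hθ
  set β := 16 / 9 * (Real.sqrt 12 + 2 * Real.sqrt α) ^ 2 with hβ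
  have hsub : {y | s < shat d α β σ y} ⊆ ⋃ s' ∈ Finset.Ioc s d,
      {y | omegaS d β σ s' < |LhatS d α σ s y - LhatS d α σ s' y|} := by
    intro y hy
    simp only [Set.mem_setOf_eq] at hy
    by_contra hcon
    simp only [Set.mem_iUnion, Set.mem_setOf_eq, Finset.mem_Ioc, not_exists, not_lt] at hcon
    refine absurd hy (not_lt.2 (Nat.sInf_le (Or.inl ⟨hs, Nat.le_floor hs0, ?_⟩)))
    intro s' h1 h2
    exact hcon s' ⟨h1, h2⟩
  have hd0 : (0 : ℝ) < d := by positivity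
  calc _ ≤ _ := measure_mono hsub
    _ ≤ ∑ s' ∈ Finset.Ioc s d, gaussMeasure d θ σ
        {y | omegaS d β σ s' < |LhatS d α σ s y - LhatS d α σ s' y|} :=
      measure_biUnion_finset_le _ _
    _ ≤ ∑ s' ∈ Finset.Ioc s d, ENNReal.ofReal (2 / (d : ℝ) ^ 6) := by
      refine Finset.sum_le_sum fun s' h => ?_
      exact pair_aux α hα d hd σ hσ s s' hs hs0 (Finset.mem_Ioc.1 h).1 θ hθ
    _ ≤ (d : ENNReal) * ENNReal.ofReal (2 / (d : ℝ) ^ 6) := by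
      rw [Finset.sum_const, Nat.card_Ioc, nsmul_eq_mul]
      gcongr
      exact Nat.sub_le _ _
    _ = _ := by
      rw [← ENNReal.ofReal_natCast, ← ENNReal.ofReal_mul hd0.le]
      congr 1
      field_simp
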